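/- Let λ : A → A with A ⊆ ℝ^m a nonempty convex compact polytope, and suppose λ is locally gross direction preserving. Then the dynamical system P(n+1) = λ(P(n)) has an equilibrium: there exists P* ∈ A with λ(P*) = P*. -/

import Mathlib

open Metric

section Auxiliary

open Set MeasureTheory Polynomial
open scoped NNReal RealInnerProductSpace

/-- A nonempty closed convex set admits a nonexpansive nearest-point map, characterised by its
variational inequality. -/
theorem exists_nearest_point_map {E : Type*} [NormedAddCommGroup E] [InnerProductSpace ℝ E]
    [CompleteSpace E] {A : Set E} (hne : A.Nonempty) (hconv : Convex ℝ A) (hclosed : IsClosed A) :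
    ∃ p : E → E, (∀ x, p x ∈ A) ∧ (∀ x, ∀ y ∈ A, ⟪x - p x, y - p x⟫ ≤ 0) ∧ LipschitzWith 1 p := by
  choose p hpA hp using exists_norm_eq_iInf_of_complete_convex hne hclosed.isComplete hconv
  have hin : ∀ x, ∀ y ∈ A, ⟪x - p x, y - p x⟫ ≤ 0 := fun x =>
    (norm_eq_iInf_iff_real_inner_le_zero hconv (hpA x)).1 (hp x)
  refine ⟨p, hpA, hin, LipschitzWith.of_dist_le_mul fun x y => ?_⟩
  have h₁ := hin x (p y) (hpA y)
  have h₂ := hin y (p x) (hpA x)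
  have h₃ : ‖p x - p y‖ * ‖p x - p y‖ ≤ ⟪x - y, p x - p y⟫ := by
    rw [← real_inner_self_eq_norm_mul_norm]
    simp only [inner_sub_left, inner_sub_right] at *
    linarith
  have h₄ := h₃.trans (real_inner_le_norm _ _)
  rw [dist_eq_norm, dist_eq_norm, NNReal.coe_one, one_mul]
  by_contra! h
  nlinarith [norm_nonneg (x - y)]

/-- A Lipschitz map on a closed ball that vanishes on the sphere extends by zero to a Lipschitz map. -/
theorem exists_lipschitz_extension_of_eq_zero_on_sphere {E F : Type*} [NormedAddCommGroup E]
    [InnerProductSpace ℝ E] [CompleteSpace E] [NormedAddCommGroup F] {g : E → F} {R : ℝ} {L : ℝ≥0}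
    (hR : 0 < R) (hg : LipschitzOnWith L g (closedBall 0 R)) (h0 : ∀ x ∈ sphere 0 R, g x = 0) :
    ∃ G : E → F, LipschitzWith L G ∧ (∀ x ∈ closedBall 0 R, G x = g x) ∧
      ∀ x ∉ ball 0 R, G x = 0 := by
  obtain ⟨p, hpA, hin, hlip⟩ := exists_nearest_point_map (E := E)
    (nonempty_closedBall.2 hR.le) (convex_closedBall 0 R) isClosed_closedBall
  have hfix : ∀ x ∈ closedBall (0 : E) R, p x = x := fun x hx => by
    have := hin x x hx
    rw [real_inner_self_eq_norm_sq] at this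
    have : ‖x - p x‖ = 0 := by nlinarith [norm_nonneg (x - p x)]
    exact (sub_eq_zero.1 (norm_eq_zero.1 this)).symm
  refine ⟨g ∘ p, ?_, fun x hx => by simp [hfix x hx], fun x hx => h0 _ ?_⟩
  · intro x y
    exact (hg (hpA x) (hpA y)).trans (by gcongr; simpa using hlip x y)
  · have hle : ‖p x‖ ≤ R := by simpa using hpA x
    rw [mem_sphere_zero_iff_norm]
    by_contra hne
    have hlt : ‖p x‖ < R := lt_of_le_of_ne hle hne
    set s : ℝ := (R - ‖p x‖) / (‖x - p x‖ + 1)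
    have hden : 0 < ‖x - p x‖ + 1 := by positivity
    have hspos : 0 < s := div_pos (by linarith) hden
    have hmem : p x + s • (x - p x) ∈ closedBall (0 : E) R := by
      rw [mem_closedBall_zero_iff]
      have h₁ : s * (‖x - p x‖ + 1) = R - ‖p x‖ := div_mul_cancel₀ _ hden.ne'
      calc ‖p x + s • (x - p x)‖ ≤ ‖p x‖ + ‖s • (x - p x)‖ := norm_add_le _ _
        _ = ‖p x‖ + s * ‖x - p x‖ := by rw [norm_smul, Real.norm_of_nonneg hspos.le]
        _ ≤ R := by nlinarith
    have := hin x _ hmem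
    rw [add_sub_cancel_left, real_inner_smul_right, real_inner_self_eq_norm_sq] at this
    have h₂ : ‖x - p x‖ = 0 := by
      by_contra h
      have : 0 < ‖x - p x‖ := lt_of_le_of_ne (norm_nonneg _) (Ne.symm h)
      have : 0 < s * ‖x - p x‖ ^ 2 := by positivity
      linarith
    have h₃ : x = p x := sub_eq_zero.1 (norm_eq_zero.1 h₂)
    rw [← h₃] at hlt
    exact hx (by simpa using hlt)

/-- A contractive perturbation of the identity is bijective. -/
theorem bijective_id_add_of_lipschitz {E : Type*} [NormedAddCommGroup E] [CompleteSpace E]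
    {G : E → E} {K : ℝ≥0} (hK : K < 1) (hG : LipschitzWith K G) :
    Function.Bijective fun x => x + G x := by
  have hc : ∀ y, ContractingWith K fun x => y - G x := fun y =>
    ⟨hK, LipschitzWith.of_dist_le_mul fun a b => by
      simpa [dist_eq_norm, norm_sub_rev] using hG.dist_le_mul a b⟩
  refine ⟨fun a b hab => ?_, fun y => ⟨(hc y).fixedPoint _, ?_⟩⟩
  · refine (hc (b + G b)).fixedPoint_unique' ?_ ?_
    · exact sub_eq_iff_eq_add.2 hab.symm
    · exact add_sub_cancel_right b (G b)
  · have h : y - G ((hc y).fixedPoint _) = (hc y).fixedPoint _ := (hc y).fixedPoint_isFixedPt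
    exact (eq_add_of_sub_eq h).symm

/-- `det (1 + t T)` is a polynomial in `t` of degree at most the dimension. -/
theorem det_id_add_smul_eq_eval {E : Type*} [NormedAddCommGroup E] [NormedSpace ℝ E]
    [FiniteDimensional ℝ E] (T : E →L[ℝ] E) :
    ∃ q : ℝ[X], q.natDegree ≤ Module.finrank ℝ E ∧
      ∀ t : ℝ, (ContinuousLinearMap.id ℝ E + t • T).det = q.eval t := by
  let b := Module.finBasis ℝ E
  let M := LinearMap.toMatrix b b (T : E →ₗ[ℝ] E)
  refine ⟨((X : ℝ[X]) • M.map C + (1 : Matrix _ _ ℝ).map C).det, ?_, fun t => ?_⟩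
  · simpa using natDegree_det_X_add_C_le M 1
  · rw [ContinuousLinearMap.det, ← LinearMap.det_toMatrix b, ← coe_evalRingHom, RingHom.map_det]
    congr 1
    ext i j
    by_cases h : i = j <;> simp [M, LinearMap.toMatrix_apply, h] <;> ring

variable {E : Type*} [NormedAddCommGroup E] [InnerProductSpace ℝ E] [FiniteDimensional ℝ E]
  [MeasurableSpace E] [BorelSpace E]

/-- For small `t`, the map `x ↦ x + t g x` permutes the ball, so its Jacobian integrates to the volume. -/
theorem setIntegral_det_id_add_smul_fderiv_eventually {g : E → E} {R : ℝ} (hR : 0 < R)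
    (hg : ∀ x ∈ closedBall 0 R, ContDiffAt ℝ 1 g x) (h0 : ∀ x ∈ sphere 0 R, g x = 0) :
    ∃ t₀ > 0, ∀ t ∈ Ioo (0 : ℝ) t₀,
      ∫ x in ball 0 R, (ContinuousLinearMap.id ℝ E + t • fderiv ℝ g x).det =
        volume.real (ball (0 : E) R) := by
  have hcont : ContinuousOn (fderiv ℝ g) (closedBall 0 R) := fun x hx =>
    ((hg x hx).fderiv_right (m := 0) (by simp)).continuousAt.continuousWithinAt
  obtain ⟨C, hC⟩ := (isCompact_closedBall (0 : E) R).exists_bound_of_continuousOn hcont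
  set L : ℝ≥0 := Real.toNNReal C
  have hbound : ∀ x ∈ closedBall (0 : E) R, ‖fderiv ℝ g x‖₊ ≤ L := fun x hx =>
    NNReal.coe_le_coe.1 ((hC x hx).trans (Real.le_coe_toNNReal C))
  have hlip : LipschitzOnWith L g (closedBall 0 R) :=
    (convex_closedBall 0 R).lipschitzOnWith_of_nnnorm_fderiv_le
      (fun x hx => (hg x hx).differentiableAt one_ne_zero) hbound
  obtain ⟨G, hGlip, hGin, hGout⟩ := exists_lipschitz_extension_of_eq_zero_on_sphere hR hlip h0
  obtain ⟨ε, hε, hdet⟩ : ∃ ε > 0, ∀ T : E →L[ℝ] E, ‖T‖ < ε →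
      0 < (ContinuousLinearMap.id ℝ E + T).det := by
    have hc : Continuous fun T : E →L[ℝ] E => (ContinuousLinearMap.id ℝ E + T).det :=
      ContinuousLinearMap.continuous_det.comp (continuous_const.add continuous_id)
    have h1 : {T : E →L[ℝ] E | 0 < (ContinuousLinearMap.id ℝ E + T).det} ∈ nhds 0 :=
      (isOpen_lt continuous_const hc).mem_nhds (by simp [ContinuousLinearMap.det])
    obtain ⟨ε, hε, h⟩ := Metric.mem_nhds_iff.1 h1
    exact ⟨ε, hε, fun T hT => h (by simpa using hT)⟩
  refine ⟨min ε 1 / (L + 1), by positivity, fun t ht => ?_⟩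
  have hL1 : (0 : ℝ) < L + 1 := by positivity
  have htL : t * (L + 1) < min ε 1 := (lt_div_iff₀ hL1).1 ht.2
  have htL' : t * L < min ε 1 := by nlinarith [ht.1]
  have hbij : Function.Bijective fun x => x + t • G x := by
    refine bijective_id_add_of_lipschitz (K := Real.toNNReal t * L) ?_
      (LipschitzWith.of_dist_le_mul fun x y => ?_)
    · rw [← NNReal.coe_lt_coe, NNReal.coe_mul, Real.coe_toNNReal t ht.1.le]
      exact htL'.trans_le (min_le_right _ _)
    · rw [dist_smul₀, Real.norm_of_nonneg ht.1.le, NNReal.coe_mul, mul_assoc,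
        Real.coe_toNNReal t ht.1.le]
      exact mul_le_mul_of_nonneg_left (hGlip.dist_le_mul x y) ht.1.le
  have hout : ∀ x ∉ ball (0 : E) R, x + t • G x = x := fun x hx => by simp [hGout x hx]
  have himage : (fun x => x + t • g x) '' ball 0 R = ball 0 R := by
    have hcongr : (fun x => x + t • g x) '' ball 0 R = (fun x => x + t • G x) '' ball 0 R :=
      image_congr fun x hx => by rw [hGin x (ball_subset_closedBall hx)]
    have hcompl : (fun x => x + t • G x) '' (ball 0 R)ᶜ = (ball 0 R)ᶜ := by
      exact (image_congr (g := id) hout).trans (image_id _)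
    rw [hcongr, ← compl_inj_iff, ← image_compl_eq hbij, hcompl]
  have hinj : InjOn (fun x => x + t • g x) (ball 0 R) := fun x hx y hy hxy => hbij.1 <| by
    simpa only [hGin x (ball_subset_closedBall hx), hGin y (ball_subset_closedBall hy)] using hxy
  have hderiv : ∀ x ∈ ball (0 : E) R, HasFDerivWithinAt (fun x => x + t • g x)
      (ContinuousLinearMap.id ℝ E + t • fderiv ℝ g x) (ball 0 R) x := fun x hx =>
    ((hasFDerivAt_id x).add (((hg x (ball_subset_closedBall hx)).differentiableAt
      one_ne_zero).hasFDerivAt.const_smul t)).hasFDerivWithinAt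
  have hpos : ∀ x ∈ ball (0 : E) R,
      0 < (ContinuousLinearMap.id ℝ E + t • fderiv ℝ g x).det := fun x hx => by
    refine hdet _ ?_
    rw [norm_smul, Real.norm_of_nonneg ht.1.le]
    calc t * ‖fderiv ℝ g x‖ ≤ t * L :=
          mul_le_mul_of_nonneg_left (hbound x (ball_subset_closedBall hx)) ht.1.le
      _ < ε := htL'.trans_le (min_le_left _ _)
  have key := integral_image_eq_integral_abs_det_fderiv_smul volume measurableSet_ball hderiv hinj
    (fun _ => (1 : ℝ))
  rw [himage] at key
  simp only [smul_eq_mul, mul_one] at key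
  rw [setIntegral_congr_fun measurableSet_ball fun x hx => (abs_of_pos (hpos x hx)).symm, ← key]
  simp

/-- The integral of the Jacobian of `x ↦ x + t g x` is polynomial in `t` and constant for small `t`,
hence equals the volume of the ball also at `t = 1`. -/
theorem setIntegral_det_id_add_fderiv {g : E → E} {R : ℝ} (hR : 0 < R)
    (hg : ∀ x ∈ closedBall 0 R, ContDiffAt ℝ 1 g x) (h0 : ∀ x ∈ sphere 0 R, g x = 0) :
    ∫ x in ball 0 R, (ContinuousLinearMap.id ℝ E + fderiv ℝ g x).det =
        volume.real (ball (0 : E) R) := by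
  obtain ⟨t₀, ht₀, ht⟩ := setIntegral_det_id_add_smul_fderiv_eventually hR hg h0
  set n := Module.finrank ℝ E
  let s := Finset.range (n + 1)
  let v : ℕ → ℝ := fun j => t₀ / (j + 2)
  have hv : InjOn v s := fun i _ j _ hij => by
    simp only [v] at hij
    field_simp at hij
    simpa using hij.symm
  have hvmem : ∀ j, v j ∈ Ioo 0 t₀ := fun j => by
    refine ⟨by positivity, div_lt_self ht₀ ?_⟩
    have : (0 : ℝ) ≤ j := by positivity
    linarith
  let l : ℕ → ℝ := fun j => (Lagrange.basis s v j).eval 1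
  have hl : ∑ j ∈ s, l j = 1 := by
    simpa [l, eval_finsetSum] using congrArg (eval 1)
      (Lagrange.sum_basis hv ⟨0, by simp [s]⟩)
  have hinterp : ∀ T : E →L[ℝ] E, (ContinuousLinearMap.id ℝ E + T).det =
      ∑ j ∈ s, l j * (ContinuousLinearMap.id ℝ E + v j • T).det := fun T => by
    obtain ⟨q, hq, hqe⟩ := det_id_add_smul_eq_eval T
    have hdeg : q.degree < s.card := by
      refine lt_of_le_of_lt degree_le_natDegree ?_
      simp only [s, Finset.card_range]
      exact_mod_cast Nat.lt_succ_of_le hq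
    have h1 := hqe 1
    rw [one_smul] at h1
    rw [h1, Lagrange.eq_interpolate hv hdeg, Lagrange.interpolate_apply, eval_finsetSum]
    refine Finset.sum_congr rfl fun j hj => ?_
    rw [eval_mul, eval_C, hqe, mul_comm]
  have hint : ∀ t : ℝ, IntegrableOn
      (fun x => (ContinuousLinearMap.id ℝ E + t • fderiv ℝ g x).det) (ball 0 R) := fun t => by
    refine IntegrableOn.mono_set (ContinuousOn.integrableOn_compact
      (isCompact_closedBall (0 : E) R) ?_) ball_subset_closedBall
    have hcont : ContinuousOn (fderiv ℝ g) (closedBall 0 R) := fun x hx =>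
      ((hg x hx).fderiv_right (m := 0) (by simp)).continuousAt.continuousWithinAt
    exact ContinuousLinearMap.continuous_det.comp_continuousOn
      (continuousOn_const.add (hcont.const_smul t))
  rw [integral_congr_ae (.of_forall fun x => hinterp (fderiv ℝ g x))]
  rw [integral_finsetSum _ fun j _ => (hint (v j)).const_mul (l j)]
  simp_rw [integral_const_mul]
  rw [Finset.sum_congr rfl fun j _ => by rw [ht (v j) (hvmem j)], ← Finset.sum_mul, hl, one_mul]

/-- There is no `C¹` retraction of a closed ball onto its boundary sphere. -/
theorem not_exists_contDiff_retraction {r : E → E} {R : ℝ} (hR : 0 < R)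
    (hr : ∀ x ∈ closedBall 0 R, ContDiffAt ℝ 1 r x) (hnorm : ∀ x ∈ closedBall 0 R, ‖r x‖ = R)
    (hfix : ∀ x ∈ sphere 0 R, r x = x) : False := by
  have key := setIntegral_det_id_add_fderiv (g := fun x => r x - x) hR
    (fun x hx => (hr x hx).sub contDiffAt_id) (fun x hx => sub_eq_zero.2 (hfix x hx))
  have hzero : ∀ x ∈ ball (0 : E) R,
      (ContinuousLinearMap.id ℝ E + fderiv ℝ (fun x => r x - x) x).det = 0 := fun x hx => by
    have hd : HasFDerivAt r (fderiv ℝ r x) x :=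
      ((hr x (ball_subset_closedBall hx)).differentiableAt one_ne_zero).hasFDerivAt
    have hsub : HasFDerivAt (fun x => r x - x) (fderiv ℝ r x - ContinuousLinearMap.id ℝ E) x :=
      hd.sub (hasFDerivAt_id x)
    rw [hsub.fderiv, add_sub_cancel]
    by_contra hdet
    have hconst : (fun y => ‖r y‖ ^ 2) =ᶠ[nhds x] fun _ => R ^ 2 := by
      filter_upwards [isOpen_ball.mem_nhds hx] with y hy
      rw [hnorm y (ball_subset_closedBall hy)]
    have hder := (hd.norm_sq.congr_of_eventuallyEq hconst.symm).unique (hasFDerivAt_const _ _)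
    obtain ⟨v, hv⟩ : ∃ v, fderiv ℝ r x v = r x :=
      ((fderiv ℝ r x).toContinuousLinearEquivOfDetNeZero hdet).surjective (r x)
    have := DFunLike.congr_fun hder v
    simp [hv, hnorm x (ball_subset_closedBall hx), hR.ne'] at this
  rw [setIntegral_congr_fun measurableSet_ball hzero, integral_zero] at key
  exact (ENNReal.toReal_pos (measure_ball_pos volume _ hR).ne' measure_ball_lt_top.ne).ne key

/-- **Brouwer's fixed point theorem** for bounded `C¹` self-maps of a Euclidean space. -/
theorem exists_fixed_point_of_contDiff_of_norm_lt {f : E → E} {R : ℝ} (hf : ContDiff ℝ 1 f)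
    (hb : ∀ x, ‖f x‖ < R) : ∃ x, f x = x := by
  by_contra! hne
  have hR : 0 < R := (norm_nonneg _).trans_lt (hb 0)
  let d : E → E := fun x => x - f x
  have hd : ContDiff ℝ 1 d := contDiff_id.sub hf
  have hd0 : ∀ x, 0 < ‖d x‖ ^ 2 := fun x => by
    have : d x ≠ 0 := sub_ne_zero.2 (hne x).symm
    positivity
  let D : E → ℝ := fun x => ⟪x, d x⟫ ^ 2 + ‖d x‖ ^ 2 * (R ^ 2 - ‖x‖ ^ 2)
  have hbdry : ∀ x ∈ sphere (0 : E) R, 0 < ⟪x, d x⟫ := fun x hx => by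
    rw [mem_sphere_zero_iff_norm] at hx
    have h₁ := real_inner_le_norm x (f x)
    have h₂ := hb x
    simp only [d, inner_sub_right, real_inner_self_eq_norm_sq]
    rw [hx] at h₁ ⊢
    nlinarith
  have hD : ∀ x ∈ closedBall (0 : E) R, 0 < D x := fun x hx => by
    rw [mem_closedBall_zero_iff] at hx
    rcases hx.lt_or_eq with h | h
    · have : 0 < R ^ 2 - ‖x‖ ^ 2 := by nlinarith [norm_nonneg x]
      have := hd0 x
      positivity
    · have := hbdry x (mem_sphere_zero_iff_norm.2 h)
      simp only [D, h, sub_self, mul_zero, add_zero]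
      positivity
  let s : E → ℝ := fun x => (√(D x) - ⟪x, d x⟫) / ‖d x‖ ^ 2
  refine not_exists_contDiff_retraction (r := fun x => x + s x • d x) hR (fun x hx => ?_)
    (fun x hx => ?_) (fun x hx => ?_)
  · have hin : ContDiff ℝ 1 fun x => ⟪x, d x⟫ := contDiff_id.inner ℝ hd
    have hDc : ContDiff ℝ 1 D :=
      (hin.pow 2).add ((hd.norm_sq ℝ).mul (contDiff_const.sub (contDiff_norm_sq ℝ)))
    exact contDiffAt_id.add (ContDiffAt.smul (((hDc.contDiffAt.sqrt (hD x hx).ne').sub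
      hin.contDiffAt).div (hd.norm_sq ℝ).contDiffAt (hd0 x).ne') hd.contDiffAt)
  · have hs : s x * ‖d x‖ ^ 2 = √(D x) - ⟪x, d x⟫ := div_mul_cancel₀ _ (hd0 x).ne'
    have hq : √(D x) ^ 2 = ⟪x, d x⟫ ^ 2 + ‖d x‖ ^ 2 * (R ^ 2 - ‖x‖ ^ 2) :=
      Real.sq_sqrt (hD x hx).le
    have hnorm : ‖x + s x • d x‖ ^ 2 = R ^ 2 := by
      rw [norm_add_sq_real, real_inner_smul_right, norm_smul, mul_pow, Real.norm_eq_abs, sq_abs]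
      refine mul_left_cancel₀ (hd0 x).ne' ?_
      linear_combination (2 * ⟪x, d x⟫ + s x * ‖d x‖ ^ 2 + (√(D x) - ⟪x, d x⟫)) * hs + hq
    exact (pow_left_inj₀ (norm_nonneg _) hR.le two_ne_zero).1 hnorm
  · have hs : s x = 0 := by
      have : D x = ⟪x, d x⟫ ^ 2 := by simp [D, mem_sphere_zero_iff_norm.1 hx]
      simp only [s]
      rw [this, Real.sqrt_sq (hbdry x hx).le, sub_self, zero_div]
    simp [hs]

/-- A convex combination of unit vectors at pairwise non-obtuse angles is bounded away from zero. -/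
theorem one_le_card_mul_norm_sq_sum {V : Type*} [NormedAddCommGroup V]
    [InnerProductSpace ℝ V] {ι : Type*} [Fintype ι] {w : ι → ℝ} {u : ι → V}
    (hw : ∀ i, 0 ≤ w i) (hsum : ∑ i, w i = 1) (hu : ∀ i, ‖u i‖ = 1)
    (huu : ∀ i j, 0 ≤ ⟪u i, u j⟫) :
    1 ≤ (Fintype.card ι : ℝ) * ‖∑ i, w i • u i‖ ^ 2 := by
  have h₁ : ∑ i, w i ^ 2 ≤ ‖∑ i, w i • u i‖ ^ 2 := by
    rw [← real_inner_self_eq_norm_sq, sum_inner]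
    refine Finset.sum_le_sum fun i _ => ?_
    rw [inner_sum]
    calc w i ^ 2 = ⟪w i • u i, w i • u i⟫ := by
          rw [real_inner_smul_left, real_inner_smul_right, real_inner_self_eq_norm_sq, hu]; ring
      _ ≤ ∑ j, ⟪w i • u i, w j • u j⟫ :=
          Finset.single_le_sum (f := fun j => ⟪w i • u i, w j • u j⟫) (fun j _ => by
            rw [real_inner_smul_left, real_inner_smul_right]
            exact mul_nonneg (hw i) (mul_nonneg (hw j) (huu i j))) (Finset.mem_univ i)
  have h₂ := sq_sum_le_card_mul_sum_sq (s := Finset.univ) (f := w)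
  rw [hsum, one_pow, Finset.card_univ] at h₂
  exact h₂.trans (by gcongr)

/-- A locally gross direction preserving self-map of a nonempty compact convex set has a fixed point.

If not, let `u` be the normalised displacement and `p` the nearest-point map of `A`. A smooth map
close to a convexification of `x ↦ p x + u (p x)` has a fixed point, where an average `V` of nearby
values of `u` almost equals `x - p x`. As displacements point into `A`, `‖V‖` is small, which the
pairwise non-obtuse angles forbid. -/
theorem exists_fixed_point_of_locally_gross_direction_preserving {A : Set E}
    (hne : A.Nonempty) (hconv : Convex ℝ A) (hcomp : IsCompact A) {f : E → E}
    (hmaps : MapsTo f A A)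
    (hf : ∀ a ∈ A, f a ≠ a → ∃ δ > 0, ∀ b ∈ ball a δ ∩ A, ∀ c ∈ ball a δ ∩ A,
      0 ≤ ⟪f b - b, f c - c⟫) :
    ∃ x ∈ A, f x = x := by
  by_contra! hfix
  obtain ⟨p, hpA, hpin, hplip⟩ := exists_nearest_point_map hne hconv hcomp.isClosed
  have hplip' : ∀ x y, ‖p x - p y‖ ≤ ‖x - y‖ := fun x y => by
    simpa [dist_eq_norm] using hplip.dist_le_mul x y
  let u : E → E := fun a => ‖f a - a‖⁻¹ • (f a - a)
  have hu : ∀ a ∈ A, ‖u a‖ = 1 := fun a ha =>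
    norm_smul_inv_norm (𝕜 := ℝ) (sub_ne_zero.2 (hfix a ha))
  choose! δ hδ hgross using fun a ha => hf a ha (hfix a ha)
  obtain ⟨ε₀, hε₀, hleb⟩ := lebesgue_number_lemma_of_metric (c := fun a : A => ball a.1 (δ a.1))
    hcomp (fun _ => isOpen_ball) fun a ha => mem_iUnion.2 ⟨⟨a, ha⟩, mem_ball_self (hδ a ha)⟩
  set n : ℝ := Module.finrank ℝ E + 1 with hn
  have hnpos : 0 < n := by positivity
  let ε := min ε₀ (1 / (4 * n))
  have hε : 0 < ε := by positivity
  let S : E → Set E := fun x => (fun a => p a + u (p a)) '' ball x ε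
  obtain ⟨K, hK⟩ := exists_contMDiffMap_forall_mem_convex_of_local_const (n := 1)
    (modelWithCornersSelf ℝ E) (t := fun x => convexHull ℝ (S x))
    (fun x => convex_convexHull ℝ _) fun x => ⟨p x + u (p x), by
      filter_upwards [ball_mem_nhds x hε] with y hy
      exact subset_convexHull ℝ _ ⟨x, mem_ball_comm.1 hy, rfl⟩⟩
  obtain ⟨M, hM⟩ := hcomp.isBounded.exists_norm_le
  obtain ⟨x, hx⟩ := exists_fixed_point_of_contDiff_of_norm_lt (R := M + 2) K.contMDiff.contDiff
    fun x => by
      have hsub : convexHull ℝ (S x) ⊆ closedBall 0 (M + 1) :=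
        convexHull_min (by
          rintro _ ⟨a, -, rfl⟩
          rw [mem_closedBall_zero_iff]
          refine (norm_add_le _ _).trans (add_le_add (hM _ (hpA a)) (hu _ (hpA a)).le))
          (convex_closedBall _ _)
      have := mem_closedBall_zero_iff.1 (hsub (hK x))
      linarith
  have hxmem := hK x
  rw [hx] at hxmem
  obtain ⟨ι, _, z, w, hz, hind, hw, hwsum, hwx⟩ := eq_pos_convex_span_of_mem_convexHull hxmem
  choose a ha haz using fun i => hz (mem_range_self i)
  replace ha : ∀ i, ‖a i - x‖ < ε := fun i => by simpa [dist_eq_norm] using ha i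
  have hcard : (Fintype.card ι : ℝ) ≤ n := by
    have := hind.card_le_finrank_succ.trans (Nat.succ_le_succ (Submodule.finrank_le _))
    rw [hn]
    exact_mod_cast this
  let V := ∑ i, w i • u (p (a i))
  have hVlow : 1 ≤ n * ‖V‖ ^ 2 := by
    refine (one_le_card_mul_norm_sq_sum (fun i => (hw i).le) hwsum
      (fun i => hu _ (hpA (a i))) fun i j => ?_).trans (by gcongr)
    obtain ⟨⟨c, hc⟩, hball⟩ := hleb (p x) (hpA x)
    have hmem : ∀ i, p (a i) ∈ ball c (δ c) ∩ A := fun i =>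
      ⟨hball (by
        rw [mem_ball, dist_eq_norm]
        exact (hplip' _ _).trans_lt ((ha i).trans_le (min_le_left _ _))), hpA _⟩
    simp only [u, real_inner_smul_left, real_inner_smul_right]
    have := hgross c hc _ (hmem i) _ (hmem j)
    positivity
  have hclose : ‖(x - p x) - V‖ ≤ ε := by
    have heq : (x - p x) - V = ∑ i, w i • (p (a i) - p x) := by
      rw [← hwx]
      simp only [← haz, V, smul_add, smul_sub, Finset.sum_add_distrib, Finset.sum_sub_distrib,
        ← Finset.sum_smul, hwsum, one_smul]
      abel
    rw [heq]
    calc ‖∑ i, w i • (p (a i) - p x)‖ ≤ ∑ i, w i * ε := by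
          refine norm_sum_le_of_le _ fun i _ => ?_
          rw [norm_smul, Real.norm_of_nonneg (hw i).le]
          exact mul_le_mul_of_nonneg_left ((hplip' _ _).trans (ha i).le) (hw i).le
      _ = ε := by rw [← Finset.sum_mul, hwsum, one_mul]
  have hinner : ∀ i, ⟪V, u (p (a i))⟫ ≤ 3 * ε := fun i => by
    have h₁ : ⟪a i - p (a i), u (p (a i))⟫ ≤ 0 := by
      rw [real_inner_smul_right]
      exact mul_nonpos_of_nonneg_of_nonpos (by positivity) (hpin _ _ (hmaps (hpA _)))
    have h₂ : ‖V - (a i - p (a i))‖ ≤ 3 * ε := by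
      calc ‖V - (a i - p (a i))‖
          = ‖-((x - p x) - V) - (a i - x) + (p (a i) - p x)‖ := by congr 1; abel
        _ ≤ ‖(x - p x) - V‖ + ‖a i - x‖ + ‖p (a i) - p x‖ := by
          refine (norm_add_le _ _).trans (add_le_add_left ((norm_sub_le _ _).trans ?_) _)
          rw [norm_neg]
        _ ≤ 3 * ε := by linarith [hplip' (a i) x, ha i]
    have h₃ := real_inner_le_norm (V - (a i - p (a i))) (u (p (a i)))
    rw [hu _ (hpA _), mul_one, inner_sub_left] at h₃
    linarith
  have hVup : ‖V‖ ^ 2 ≤ 3 * ε := by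
    calc ‖V‖ ^ 2 = ∑ i, w i * ⟪V, u (p (a i))⟫ := by
          rw [← real_inner_self_eq_norm_sq]
          conv_lhs => rw [show ⟪V, V⟫ = ⟪V, ∑ i, w i • u (p (a i))⟫ from rfl, inner_sum]
          simp only [real_inner_smul_right]
      _ ≤ ∑ i, w i * (3 * ε) :=
          Finset.sum_le_sum fun i _ => mul_le_mul_of_nonneg_left (hinner i) (hw i).le
      _ = 3 * ε := by rw [← Finset.sum_mul, hwsum, one_mul]
  have hεn : n * ε ≤ 1 / 4 := by
    calc n * ε ≤ n * (1 / (4 * n)) := by gcongr; exact min_le_right _ _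
      _ = 1 / 4 := by field_simp
  nlinarith

end Auxiliary

theorem herings_fixed_point
    (m : ℕ) (A : Set (EuclideanSpace ℝ (Fin m)))
    (hne : A.Nonempty) (hconv : Convex ℝ A) (hcomp : IsCompact A)
    (lam : EuclideanSpace ℝ (Fin m) → EuclideanSpace ℝ (Fin m))
    (hmaps : Set.MapsTo lam A A)
    (hlgdp : ∀ a ∈ A, lam a ≠ a →
      ∃ δ > 0, ∀ b ∈ ball a δ ∩ A, ∀ c ∈ ball a δ ∩ A,
        0 ≤ inner (𝕜 := ℝ) (lam b - b) (lam c - c)) :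
    ∃ P ∈ A, lam P = P :=
  exists_fixed_point_of_locally_gross_direction_preserving hne hconv hcomp hmaps hlgdp
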